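/- For every z ∈ ℂ with z ∉ (-∞,0], the derivative at ν = −1 of the map ν ↦ y_ν(z) equals −(Ci(2z)·sin z − (Si(2z) − π)·cos z)/z. -/

import Mathlib

open Complex

/-- The Bessel function of the first kind
`J_ν(z) = (z/2)^ν ∑_{k≥0} (−1)^k (z²/4)^k / (k! Γ(ν+k+1))`, with the principal power. -/
noncomputable def besselJ (ν z : ℂ) : ℂ :=
  (z / 2) ^ ν *
    ∑' k : ℕ, (-1) ^ k * (z ^ 2 / 4) ^ k / ((k.factorial : ℂ) * Complex.Gamma (ν + k + 1))

/-- The spherical Bessel function of the second kind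
`y_ν(z) = √(π/(2z)) (J_{ν+1/2}(z) cos((ν+1/2)π) − J_{−ν−1/2}(z)) / sin((ν+1/2)π)`. -/
noncomputable def sphBesselY (ν z : ℂ) : ℂ :=
  ((Real.pi : ℂ) / (2 * z)) ^ ((1 : ℂ) / 2) *
    (besselJ (ν + 1 / 2) z * Complex.cos ((ν + 1 / 2) * Real.pi) - besselJ (-ν - 1 / 2) z) /
      Complex.sin ((ν + 1 / 2) * Real.pi)

/-- The sine integral `Si(z) = ∑_{n≥0} (−1)ⁿ z^{2n+1}/((2n+1)(2n+1)!)`. -/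
noncomputable def sinIntegral (z : ℂ) : ℂ :=
  ∑' n : ℕ, (-1) ^ n * z ^ (2 * n + 1) / ((2 * (n : ℂ) + 1) * ((2 * n + 1).factorial : ℂ))

/-- The cosine integral `Ci(z) = γ + Log z + ∑_{n≥1} (−1)ⁿ z^{2n}/(2n·(2n)!)`. -/
noncomputable def cosIntegral (z : ℂ) : ℂ :=
  (Real.eulerMascheroniConstant : ℂ) + Complex.log z +
    ∑' n : ℕ, (-1) ^ (n + 1) * z ^ (2 * (n + 1)) /
      ((2 * ((n : ℂ) + 1)) * ((2 * (n + 1)).factorial : ℂ))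


noncomputable def oddH (k : ℕ) : ℂ := ∑ j ∈ Finset.range (k + 1), 1 / (2 * (j : ℂ) + 1)

noncomputable def bco (m : ℕ) : ℂ :=
  ∑ n ∈ Finset.range (m + 1), (m.choose n : ℂ) * 2 ^ n * (-1) ^ (m + n) / n

theorem bco_zero : bco 0 = 0 := by simp [bco]

theorem bco_succ (m : ℕ) : bco (m + 1) + bco m = (1 + (-1) ^ m) / ((m : ℂ) + 1) := by
  have hm : (m : ℂ) + 1 ≠ 0 := by exact_mod_cast Nat.succ_ne_zero m
  have h1 : bco m = ∑ n ∈ Finset.range (m + 1),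
      (m.choose (n + 1) : ℂ) * 2 ^ (n + 1) * (-1) ^ (m + (n + 1)) / ((n + 1 : ℕ) : ℂ) := by
    rw [bco, Finset.sum_range_succ']
    rw [Finset.sum_range_succ _ m]
    simp
  have h2 : bco (m + 1) = ∑ n ∈ Finset.range (m + 1),
      ((m + 1).choose (n + 1) : ℂ) * 2 ^ (n + 1) * (-1) ^ (m + 1 + (n + 1)) / ((n + 1 : ℕ) : ℂ) := by
    rw [bco, Finset.sum_range_succ']
    simp
  have h3 : (1 : ℂ) ^ (m + 1) = ∑ n ∈ Finset.range (m + 1 + 1),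
      ((m + 1).choose n : ℂ) * 2 ^ n * (-1) ^ (m + 1 + n) := by
    have := add_pow (2 : ℂ) (-1) (m + 1)
    rw [show (2 : ℂ) + -1 = 1 by norm_num] at this
    rw [this]
    refine Finset.sum_congr rfl fun n hn => ?_
    have hn' : n ≤ m + 1 := by simpa [Nat.lt_succ_iff] using hn
    have : (-1 : ℂ) ^ (m + 1 + n) = (-1) ^ (m + 1 - n) := by
      obtain ⟨d, hd⟩ := Nat.exists_eq_add_of_le hn'
      rw [hd, show n + d + n = d + 2 * n by ring, pow_add _ d, pow_mul]
      simp
    rw [this]; ring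
  rw [Finset.sum_range_succ'] at h3
  rw [h1, h2, ← Finset.sum_add_distrib, eq_div_iff hm, Finset.sum_mul]
  have h4 : (1 : ℂ) + (-1) ^ m = ∑ n ∈ Finset.range (m + 1),
      ((m + 1).choose (n + 1) : ℂ) * 2 ^ (n + 1) * (-1) ^ (m + 1 + (n + 1)) := by
    rw [one_pow] at h3
    simp only [Nat.choose_zero_right, pow_zero, add_zero, Nat.cast_one, mul_one, one_mul] at h3
    linear_combination h3
  rw [h4]
  refine Finset.sum_congr rfl fun n _ => ?_
  have hn : ((n : ℂ) + 1) ≠ 0 := by exact_mod_cast Nat.succ_ne_zero n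
  have e1 : ((m + 1).choose (n + 1) : ℂ) = m.choose n + m.choose (n + 1) := by
    exact_mod_cast Nat.choose_succ_succ m n
  have e2 : ((m : ℂ) + 1) * m.choose n = (m + 1).choose (n + 1) * (n + 1) := by
    exact_mod_cast Nat.add_one_mul_choose_eq m n
  push_cast
  rw [← add_div, div_mul_eq_mul_div, div_eq_iff hn]
  rw [show m + (n + 1) = m + n + 1 by ring, show m + 1 + (n + 1) = m + n + 1 + 1 by ring]
  simp only [pow_succ _ (m + n + 1), pow_succ _ (m + n)]
  linear_combination (2 ^ (n + 1) * (-1) ^ (m + n)) * e2 +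
    (2 ^ (n + 1) * (-1) ^ (m + n)) * (m + 1) * e1

theorem bco_odd (k : ℕ) : bco (2 * k + 1) = 2 * oddH k := by
  induction k with
  | zero => 
    have := bco_succ 0
    rw [bco_zero] at this
    simp [oddH] at this ⊢
    rw [this]; norm_num
  | succ k ih =>
    have a := bco_succ (2 * k + 1)
    have b := bco_succ (2 * k + 1 + 1)
    rw [show 2 * (k + 1) + 1 = 2 * k + 1 + 1 + 1 by ring, oddH, Finset.sum_range_succ]
    rw [oddH] at ih
    simp only [pow_succ, pow_mul] at a b
    norm_num at a b
    push_cast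
    rw [ih] at a
    rw [show (2 * ((k : ℂ) + 1) + 1) = 2 * k + 1 + 1 + 1 by ring]
    linear_combination b - a

noncomputable def Ein (x : ℂ) : ℂ := ∑' n : ℕ, x ^ n / ((n : ℂ) * (n.factorial : ℂ))

theorem Ein_summable (x : ℂ) : Summable fun n : ℕ => ‖x ^ n / ((n : ℂ) * (n.factorial : ℂ))‖ := by
  refine Summable.of_nonneg_of_le (fun _ => norm_nonneg _) (fun n => ?_)
    (Real.summable_pow_div_factorial ‖x‖)
  rw [norm_div, norm_mul, norm_pow, Complex.norm_natCast, Complex.norm_natCast]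
  rcases Nat.eq_zero_or_pos n with rfl | hn
  · simp
  · have : (1 : ℝ) ≤ n := by exact_mod_cast hn
    have h2 : (0 : ℝ) < n.factorial := by exact_mod_cast n.factorial_pos
    gcongr
    nlinarith

theorem Ein_mul_exp (x : ℂ) :
    HasSum (fun m : ℕ => bco m * x ^ m / m.factorial) (Ein (2 * x) * exp (-x)) := by
  have hf := Ein_summable (2 * x)
  have hg : Summable fun n : ℕ => ‖(-x) ^ n / (n.factorial : ℂ)‖ := by
    simpa [norm_div] using Real.summable_pow_div_factorial ‖x‖
  have he : exp (-x) = ∑' n : ℕ, (-x) ^ n / (n.factorial : ℂ) := by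
    rw [Complex.exp_eq_exp_ℂ]
    exact (NormedSpace.expSeries_div_hasSum_exp (-x)).tsum_eq.symm
  have key := tsum_mul_tsum_eq_tsum_sum_range_of_summable_norm hf hg
  have hs := (summable_norm_sum_mul_range_of_summable_norm hf hg).of_norm
  rw [← he] at key
  change Ein (2 * x) * _ = _ at key
  rw [key]
  convert! hs.hasSum using 1
  ext m
  rw [bco, Finset.sum_mul, Finset.sum_div]
  refine Finset.sum_congr rfl fun n hn => ?_
  have hn' : n ≤ m := by simpa [Nat.lt_succ_iff] using hn
  obtain ⟨d, rfl⟩ := Nat.exists_eq_add_of_le hn'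
  rcases Nat.eq_zero_or_pos n with rfl | hn0
  · simp
  have h0 : (n : ℂ) ≠ 0 := by exact_mod_cast hn0.ne'
  have h1 : (n.factorial : ℂ) ≠ 0 := by exact_mod_cast n.factorial_ne_zero
  have h2 : (d.factorial : ℂ) ≠ 0 := by exact_mod_cast d.factorial_ne_zero
  have h3 : ((n + d).factorial : ℂ) ≠ 0 := by exact_mod_cast (n + d).factorial_ne_zero
  have h4 : ((n + d).choose n : ℂ) * n.factorial * d.factorial = (n + d).factorial := by
    have := Nat.choose_mul_factorial_mul_factorial (Nat.le_add_right n d)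
    rw [Nat.add_sub_cancel_left] at this
    exact_mod_cast this
  have h5 : (-1 : ℂ) ^ (n + d + n) = (-1) ^ d := by
    rw [show n + d + n = d + 2 * n by ring, pow_add _ d, pow_mul]
    simp
  rw [h5, Nat.add_sub_cancel_left, ← h4, neg_pow x, mul_pow, pow_add]
  have h6 : ((n + d).choose n : ℂ) ≠ 0 := by
    exact_mod_cast (Nat.choose_pos (Nat.le_add_right n d)).ne'
  field_simp

noncomputable def cinS (w : ℂ) : ℂ := ∑' n : ℕ, (-1) ^ (n + 1) * w ^ (2 * (n + 1)) /
      ((2 * ((n : ℂ) + 1)) * ((2 * (n + 1)).factorial : ℂ))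

noncomputable def sinS (z : ℂ) : ℂ :=
  ∑' n : ℕ, (-1) ^ n * z ^ (2 * n + 1) / ((2 * (n : ℂ) + 1) * ((2 * n + 1).factorial : ℂ))

theorem Ein_I (w : ℂ) : Ein (I * w) = cinS w + I * sinS w := by
  have hs := (Ein_summable (I * w)).of_norm
  have i2 : Function.Injective fun n : ℕ => 2 * n := fun a b h => by simpa using h
  have i3 : Function.Injective fun n : ℕ => 2 * n + 1 := fun a b h => by simpa using h
  set f : ℕ → ℂ := fun n => (I * w) ^ n / ((n : ℂ) * (n.factorial : ℂ)) with hf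
  have he : Summable fun n => f (2 * n) := hs.comp_injective i2
  have ho : Summable fun n => f (2 * n + 1) := hs.comp_injective i3
  have h := tsum_even_add_odd (f := f) he ho
  rw [he.tsum_eq_zero_add] at h
  change ∑' n, f n = _
  rw [← h, cinS, sinS, ← tsum_mul_left]
  congr 1
  · simp only [hf]
    simp only [mul_zero, Nat.cast_zero, zero_mul, div_zero, zero_add]
    refine tsum_congr fun n => ?_
    rw [mul_pow, pow_mul I, I_sq]
    push_cast; ring
  · refine tsum_congr fun n => ?_
    simp only [hf]
    rw [mul_pow, pow_succ I, pow_mul I, I_sq]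
    push_cast; ring

theorem cinS_neg (w : ℂ) : cinS (-w) = cinS w := by
  simp [cinS, pow_mul]

theorem sinS_neg (w : ℂ) : sinS (-w) = -sinS w := by
  rw [sinS, sinS, ← tsum_neg]
  refine tsum_congr fun n => ?_
  simp only [pow_succ, pow_mul]
  ring

theorem main_series (z : ℂ) :
    HasSum (fun k : ℕ => (-1) ^ k * z ^ (2 * k + 1) / ((2 * k + 1).factorial : ℂ) * (2 * oddH k))
      (sinS (2 * z) * cos z - cinS (2 * z) * sin z) := by
  have h := (Ein_mul_exp (I * z)).sub (Ein_mul_exp (-(I * z)))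
  have i3 : Function.Injective fun n : ℕ => 2 * n + 1 := fun a b h => by simpa using h
  rw [← i3.hasSum_iff] at h
  · have h' := h.div_const (2 * I)
    convert! h' using 1
    · ext k
      simp only [Function.comp]
      rw [bco_odd, mul_pow, neg_mul_eq_mul_neg, mul_pow, Odd.neg_pow ⟨k, rfl⟩, pow_succ I, pow_mul I, I_sq]
      field_simp [I_ne_zero]
      ring
    · rw [show 2 * (I * z) = I * (2 * z) by ring, show 2 * -(I * z) = I * (-(2 * z)) by ring,
        Ein_I, Ein_I, cinS_neg, sinS_neg, neg_neg,
        show -(I * z) = (-z) * I by ring, show I * z = z * I by ring, exp_mul_I, exp_mul_I, cos_neg, sin_neg]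
      rw [eq_div_iff (by simp)]
      ring
  · intro m hm
    have : Even m := by
      rw [← Nat.not_odd_iff_even]
      rintro ⟨k, rfl⟩
      exact hm ⟨k, rfl⟩
    rw [this.neg_pow, sub_self]
theorem nat_half_ne (k m : ℕ) : (1 / 2 + k : ℂ) ≠ -m := by
  intro h
  have h' : ((1 + 2 * k + 2 * m : ℕ) : ℂ) = 0 := by
    push_cast; linear_combination 2 * h
  have := Nat.cast_eq_zero.mp h'
  omega

theorem gam_half (k : ℕ) : (k.factorial : ℂ) * Gamma (1 / 2 + k) * 4 ^ k =
    ((2 * k).factorial : ℂ) * (Real.pi : ℂ) ^ (1 / 2 : ℂ) := by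
  induction k with
  | zero => simp [Complex.Gamma_one_half_eq, -one_div]
  | succ k ih =>
    have h0 : (1 / 2 + k : ℂ) ≠ 0 := by simpa using nat_half_ne k 0
    rw [show (1 / 2 + (k + 1 : ℕ) : ℂ) = (1 / 2 + k) + 1 by push_cast; ring, Gamma_add_one _ h0,
      show 2 * (k + 1) = 2 * k + 1 + 1 by ring, Nat.factorial_succ (2 * k + 1),
      Nat.factorial_succ (2 * k), Nat.factorial_succ k]
    push_cast
    rw [pow_succ]
    linear_combination (2 * k + 1 + 1) * (2 * k + 1) * ih

theorem gam_half' (k : ℕ) : (k.factorial : ℂ) * Gamma (1 / 2 + k + 1) * (2 * 4 ^ k) =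
    ((2 * k + 1).factorial : ℂ) * (Real.pi : ℂ) ^ (1 / 2 : ℂ) := by
  have h0 : (1 / 2 + k : ℂ) ≠ 0 := by simpa using nat_half_ne k 0
  rw [Gamma_add_one _ h0, Nat.factorial_succ (2 * k)]
  push_cast
  linear_combination (2 * k + 1) * gam_half k

theorem digamma_half (k : ℕ) : digamma (1 / 2 + k + 1) =
    - 2 * log 2 - Real.eulerMascheroniConstant + 2 * oddH k := by
  induction k with
  | zero =>
    have := digamma_apply_add_one (1 / 2 + (0 : ℕ)) (nat_half_ne 0)
    rw [this]
    simp only [Nat.cast_zero, add_zero, digamma_one_half, oddH]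
    norm_num
  | succ k ih =>
    have := digamma_apply_add_one (1 / 2 + (k + 1 : ℕ)) (nat_half_ne (k + 1))
    rw [this, show (1 / 2 + (k + 1 : ℕ) : ℂ) = 1 / 2 + k + 1 by push_cast; ring, ih]
    simp only [oddH]
    rw [Finset.sum_range_succ _ (k + 1)]
    have h1 : (1 / 2 + k + 1 : ℂ) ≠ 0 := by
      have := nat_half_ne (k + 1) 0
      push_cast at this
      simpa [add_assoc] using this
    have h2 : (2 * ((k + 1 : ℕ) : ℂ) + 1) = 2 * (1 / 2 + k + 1) := by push_cast; ring
    rw [h2]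
    field_simp
    try ring

noncomputable def bterm (w : ℂ) (k : ℕ) (μ : ℂ) : ℂ :=
  (-1) ^ k * w ^ k / ((k.factorial : ℂ) * Gamma (μ + k + 1))

theorem bterm_eq (w : ℂ) (k : ℕ) : bterm w k =
    fun μ => ((-1) ^ k * w ^ k / (k.factorial : ℂ)) * (Gamma (μ + k + 1))⁻¹ := by
  ext μ
  rw [bterm, div_mul_eq_div_div, div_eq_mul_inv]

theorem bterm_differentiable (w : ℂ) (k : ℕ) : Differentiable ℂ (bterm w k) := by
  rw [bterm_eq]
  have h : Differentiable ℂ fun μ : ℂ => μ + k + 1 := by fun_prop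
  exact (differentiable_one_div_Gamma.comp h).const_mul _

theorem inv_Gamma_bound (μ : ℂ) (hμ : -1 < μ.re) (k : ℕ) :
    ‖(Gamma (μ + (k + 1 : ℕ) + 1))⁻¹‖ ≤ ‖(Gamma (μ + 2))⁻¹‖ := by
  induction k with
  | zero => 
    rw [show μ + (0 + 1 : ℕ) + 1 = μ + 2 by push_cast; ring]
  | succ k ih =>
    refine le_trans ?_ ih
    have := one_div_Gamma_eq_self_mul_one_div_Gamma_add_one (μ + (k + 1 : ℕ) + 1)
    rw [this, norm_mul, show μ + (k + 1 : ℕ) + 1 + 1 = μ + (k + 1 + 1 : ℕ) + 1 by push_cast; ring]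
    refine le_mul_of_one_le_left (norm_nonneg _) ?_
    refine le_trans ?_ (Complex.re_le_norm _)
    simp
    have : (0 : ℝ) ≤ k := Nat.cast_nonneg k
    linarith

theorem bterm_bound (w : ℂ) : ∃ M : ℝ, ∀ (k : ℕ) (μ : ℂ), μ ∈ Metric.ball (0 : ℂ) (9 / 10) →
    ‖bterm w k μ‖ ≤ M * (‖w‖ ^ k / k.factorial) := by
  have hc : Continuous fun μ : ℂ => ‖(Gamma (μ + 1))⁻¹‖ + ‖(Gamma (μ + 2))⁻¹‖ := by
    have h1 : Continuous fun μ : ℂ => (Gamma (μ + 1))⁻¹ :=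
      differentiable_one_div_Gamma.continuous.comp (f := fun μ : ℂ => μ + 1) (by fun_prop)
    have h2 : Continuous fun μ : ℂ => (Gamma (μ + 2))⁻¹ :=
      differentiable_one_div_Gamma.continuous.comp (f := fun μ : ℂ => μ + 2) (by fun_prop)
    exact h1.norm.add h2.norm
  obtain ⟨M, hM⟩ := (isCompact_closedBall (0 : ℂ) (9 / 10)).exists_bound_of_continuousOn
    hc.continuousOn
  refine ⟨M, fun k μ hμ => ?_⟩
  have hM' := hM μ (Metric.ball_subset_closedBall hμ)
  rw [Real.norm_of_nonneg (by positivity)] at hM'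
  have hre : -1 < μ.re := by
    have := Complex.abs_re_le_norm μ
    rw [mem_ball_zero_iff] at hμ
    have := (abs_le.mp this).1
    linarith
  have hb : ‖(Gamma (μ + k + 1))⁻¹‖ ≤ M := by
    refine le_trans ?_ hM'
    cases k with
    | zero => simp
    | succ k =>
      refine (inv_Gamma_bound μ hre k).trans ?_
      simp
  rw [bterm_eq]
  simp only [norm_mul, norm_div, norm_pow, norm_neg, norm_one, one_pow, one_mul,
    Complex.norm_natCast]
  rw [mul_comm]
  gcongr

theorem bsum_summable (w : ℂ) (M : ℝ) : Summable fun k : ℕ => M * (‖w‖ ^ k / k.factorial) :=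
  (Real.summable_pow_div_factorial ‖w‖).mul_left M

theorem bsum_diff (w μ : ℂ) (hμ : μ ∈ Metric.ball (0 : ℂ) (9 / 10)) :
    DifferentiableAt ℂ (fun μ => ∑' k, bterm w k μ) μ := by
  obtain ⟨M, hM⟩ := bterm_bound w
  exact (differentiableOn_tsum_of_summable_norm (bsum_summable w M)
    (fun k => (bterm_differentiable w k).differentiableOn) Metric.isOpen_ball hM).differentiableAt
      (Metric.isOpen_ball.mem_nhds hμ)

theorem bsum_deriv (w μ : ℂ) (hμ : μ ∈ Metric.ball (0 : ℂ) (9 / 10)) :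
    HasSum (fun k => deriv (bterm w k) μ) (deriv (fun μ => ∑' k, bterm w k μ) μ) := by
  obtain ⟨M, hM⟩ := bterm_bound w
  exact hasSum_deriv_of_summable_norm (bsum_summable w M)
    (fun k => (bterm_differentiable w k).differentiableOn) Metric.isOpen_ball hM hμ

theorem bterm_deriv_half (w : ℂ) (k : ℕ) :
    deriv (bterm w k) (1 / 2) = -(bterm w k (1 / 2) * digamma (1 / 2 + k + 1)) := by
  have hne : ∀ m : ℕ, (1 / 2 + k + 1 : ℂ) ≠ -m := by
    intro m
    have := nat_half_ne (k + 1) m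
    push_cast at this
    rwa [← add_assoc] at this
  have h1 : HasDerivAt Gamma (deriv Gamma (1 / 2 + k + 1)) (1 / 2 + k + 1) :=
    (differentiableAt_Gamma _ hne).hasDerivAt
  have hG := Gamma_ne_zero hne
  have h2 : HasDerivAt (fun μ : ℂ => μ + k + 1) 1 (1 / 2) :=
    ((hasDerivAt_id _).add_const _).add_const _
  have h3 := ((h1.comp (1 / 2 : ℂ) h2).fun_inv hG).const_mul
    ((-1) ^ k * w ^ k / (k.factorial : ℂ))
  rw [bterm_eq]
  refine h3.deriv.trans ?_
  rw [digamma_def, logDeriv_apply]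
  simp only [Function.comp]
  field_simp

theorem pi_half_ne : (Real.pi : ℂ) ^ (1 / 2 : ℂ) ≠ 0 := by
  rw [Ne, cpow_eq_zero_iff]
  simp [Real.pi_ne_zero]

theorem bterm_half (z : ℂ) (k : ℕ) : z * bterm (z ^ 2 / 4) k (1 / 2) =
    2 / (Real.pi : ℂ) ^ (1 / 2 : ℂ) * ((-1) ^ k * z ^ (2 * k + 1) / ((2 * k + 1).factorial : ℂ)) := by
  have hP := pi_half_ne
  have h := gam_half' k
  have hf : ((2 * k + 1).factorial : ℂ) ≠ 0 := by exact_mod_cast (2 * k + 1).factorial_ne_zero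
  have h4 : (4 : ℂ) ^ k ≠ 0 := pow_ne_zero _ (by norm_num)
  have hd : (k.factorial : ℂ) * Gamma (1 / 2 + k + 1) ≠ 0 := by
    intro h0
    rw [h0, zero_mul] at h
    exact mul_ne_zero hf hP h.symm
  rw [bterm, div_pow, pow_succ _ (2 * k), pow_mul]
  generalize (Gamma (1 / 2 + k + 1)) = G at *
  generalize (Real.pi : ℂ) ^ (1 / 2 : ℂ) = P at *
  generalize (z ^ 2) ^ k = Z at *
  generalize (-1 : ℂ) ^ k = e at *
  rw [mul_div_assoc', mul_div_assoc', mul_div_assoc', div_div, div_mul_div_comm,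
    div_eq_div_iff (mul_ne_zero h4 hd) (mul_ne_zero hP hf)]
  linear_combination (-1) * z * Z * e * h

theorem bterm_neg_half (z : ℂ) (k : ℕ) : bterm (z ^ 2 / 4) k (-1 / 2) =
    1 / (Real.pi : ℂ) ^ (1 / 2 : ℂ) * ((-1) ^ k * z ^ (2 * k) / ((2 * k).factorial : ℂ)) := by
  have hP := pi_half_ne
  have h := gam_half k
  have hf : ((2 * k).factorial : ℂ) ≠ 0 := by exact_mod_cast (2 * k).factorial_ne_zero
  have h4 : (4 : ℂ) ^ k ≠ 0 := pow_ne_zero _ (by norm_num)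
  have hd : (k.factorial : ℂ) * Gamma (1 / 2 + k) ≠ 0 := by
    intro h0
    rw [h0, zero_mul] at h
    exact mul_ne_zero hf hP h.symm
  rw [bterm, show (-1 / 2 + k + 1 : ℂ) = 1 / 2 + k by ring, div_pow, pow_mul]
  generalize (Gamma (1 / 2 + k)) = G at *
  generalize (Real.pi : ℂ) ^ (1 / 2 : ℂ) = P at *
  generalize (z ^ 2) ^ k = Z at *
  generalize (-1 : ℂ) ^ k = e at *
  rw [mul_div_assoc', div_div, div_mul_div_comm,
    div_eq_div_iff (mul_ne_zero h4 hd) (mul_ne_zero hP hf)]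
  linear_combination (-1) * Z * e * h

theorem bsum_half (z : ℂ) : z * ∑' k, bterm (z ^ 2 / 4) k (1 / 2) =
    2 / (Real.pi : ℂ) ^ (1 / 2 : ℂ) * sin z := by
  rw [← tsum_mul_left, ← ((hasSum_sin z).mul_left _).tsum_eq]
  exact tsum_congr fun k => bterm_half z k

theorem bsum_neg_half (z : ℂ) : ∑' k, bterm (z ^ 2 / 4) k (-1 / 2) =
    1 / (Real.pi : ℂ) ^ (1 / 2 : ℂ) * cos z := by
  rw [← ((hasSum_cos z).mul_left _).tsum_eq]
  exact tsum_congr fun k => bterm_neg_half z k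

theorem half_mem : (1 / 2 : ℂ) ∈ Metric.ball (0 : ℂ) (9 / 10) := by
  rw [mem_ball_zero_iff]; norm_num

theorem neg_half_mem : (-1 / 2 : ℂ) ∈ Metric.ball (0 : ℂ) (9 / 10) := by
  rw [mem_ball_zero_iff]; norm_num

theorem bsum_deriv_half (z : ℂ) :
    z * deriv (fun μ => ∑' k, bterm (z ^ 2 / 4) k μ) (1 / 2) =
    -(2 / (Real.pi : ℂ) ^ (1 / 2 : ℂ)) *
      ((- 2 * log 2 - Real.eulerMascheroniConstant) * sin z +
        (sinS (2 * z) * cos z - cinS (2 * z) * sin z)) := by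
  have h1 := (bsum_deriv (z ^ 2 / 4) (1 / 2) half_mem).mul_left z
  have h2 := (((hasSum_sin z).mul_left (- 2 * log 2 - Real.eulerMascheroniConstant : ℂ)).add
    (main_series z)).mul_left (-(2 / (Real.pi : ℂ) ^ (1 / 2 : ℂ)))
  refine h1.unique ?_
  convert! h2 using 1
  ext k
  rw [bterm_deriv_half, digamma_half]
  linear_combination (-(-2 * log 2 - Real.eulerMascheroniConstant + 2 * oddH k)) * bterm_half z k

theorem besselJ_eq (z : ℂ) : (fun μ => besselJ μ z) =
    fun μ => (z / 2) ^ μ * ∑' k, bterm (z ^ 2 / 4) k μ := rfl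

theorem besselJ_hasDerivAt (z μ : ℂ) (hz : z ≠ 0) (hμ : μ ∈ Metric.ball (0 : ℂ) (9 / 10)) :
    HasDerivAt (fun μ => besselJ μ z) ((z / 2) ^ μ * log (z / 2) * (∑' k, bterm (z ^ 2 / 4) k μ) +
      (z / 2) ^ μ * deriv (fun μ => ∑' k, bterm (z ^ 2 / 4) k μ) μ) μ := by
  rw [besselJ_eq]
  have h1 := (bsum_diff (z ^ 2 / 4) μ hμ).hasDerivAt
  have h2 := (hasDerivAt_id μ).const_cpow (c := z / 2) (Or.inl (div_ne_zero hz two_ne_zero))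
  simp only [id, mul_one] at h2
  exact h2.mul h1

theorem sqrt_prod (z : ℂ) (hz : z ∈ slitPlane) :
    ((Real.pi : ℂ) / (2 * z)) ^ ((1 : ℂ) / 2) * (z / 2) ^ (1 / 2 : ℂ) =
      (Real.pi : ℂ) ^ (1 / 2 : ℂ) / 2 := by
  have hz0 : z ≠ 0 := slitPlane_ne_zero hz
  have hpi : (Real.pi : ℂ) ≠ 0 := by simp [Real.pi_ne_zero]
  have e1 : (Real.pi : ℂ) / (2 * z) = ((Real.pi / 2 : ℝ) : ℂ) * z⁻¹ := by
    push_cast; field_simp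
  have e2 : z / 2 = ((1 / 2 : ℝ) : ℂ) * z := by push_cast; ring
  have l1 : log ((Real.pi : ℂ) / (2 * z)) = Real.log Real.pi - Real.log 2 - log z := by
    rw [e1, log_ofReal_mul (by positivity) (inv_ne_zero hz0), log_inv _ (slitPlane_arg_ne_pi hz),
      Real.log_div Real.pi_ne_zero two_ne_zero]
    push_cast; ring
  have l2 : log (z / 2) = log z - Real.log 2 := by
    rw [e2, log_ofReal_mul (by positivity) hz0, Real.log_div one_ne_zero two_ne_zero, Real.log_one]
    push_cast; ring
  rw [cpow_def_of_ne_zero (div_ne_zero hpi (mul_ne_zero two_ne_zero hz0)),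
    cpow_def_of_ne_zero (div_ne_zero hz0 two_ne_zero), cpow_def_of_ne_zero hpi, ← exp_add, l1, l2,
    ← ofReal_log Real.pi_pos.le]
  have h2 : exp ((Real.log 2 : ℝ) : ℂ) = 2 := by
    rw [← ofReal_exp, Real.exp_log two_pos]; simp
  rw [eq_div_iff two_ne_zero]
  refine (congrArg (_ * ·) h2.symm).trans ?_
  rw [← exp_add]
  congr 1
  ring

theorem stmt9 (z : ℂ) (hz : z ∉ Complex.ofReal '' Set.Iic (0 : ℝ)) :
    deriv (fun ν : ℂ => sphBesselY ν z) (-1) =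
      -((cosIntegral (2 * z) * Complex.sin z -
        (sinIntegral (2 * z) - Real.pi) * Complex.cos z) / z) := by
  have hs : z ∈ slitPlane := by
    rw [mem_slitPlane_iff]
    by_contra! h
    exact hz ⟨z.re, h.1, by apply Complex.ext <;> simp [h.2]⟩
  have hz0 : z ≠ 0 := slitPlane_ne_zero hs
  have a1 : HasDerivAt (fun ν : ℂ => ν + 1 / 2) 1 (-1) := (hasDerivAt_id _).add_const _
  have a2 : HasDerivAt (fun ν : ℂ => -ν - 1 / 2) (-1) (-1) := (hasDerivAt_id _).neg.sub_const _
  have a3 : HasDerivAt (fun ν : ℂ => (ν + 1 / 2) * (Real.pi : ℂ)) (1 * Real.pi) (-1) :=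
    a1.mul_const _
  have v1 : (-1 + 1 / 2 : ℂ) = -1 / 2 := by norm_num
  have v2 : (-(-1) - 1 / 2 : ℂ) = 1 / 2 := by norm_num
  have j1 := besselJ_hasDerivAt z (-1 / 2) hz0 neg_half_mem
  have j2 := besselJ_hasDerivAt z (1 / 2) hz0 half_mem
  rw [← v1] at j1
  rw [← v2] at j2
  have k1 := j1.comp (-1 : ℂ) a1
  have k2 := j2.comp (-1 : ℂ) a2
  have hcos : Complex.cos ((-1 + 1 / 2) * (Real.pi : ℂ)) = 0 := by
    rw [v1, show (-1 / 2 * (Real.pi : ℂ)) = -(Real.pi / 2) by ring, Complex.cos_neg,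
      Complex.cos_pi_div_two]
  have hsin : Complex.sin ((-1 + 1 / 2) * (Real.pi : ℂ)) = -1 := by
    rw [v1, show (-1 / 2 * (Real.pi : ℂ)) = -(Real.pi / 2) by ring, Complex.sin_neg,
      Complex.sin_pi_div_two]
  have key := (((k1.mul a3.ccos).sub k2).const_mul
    (((Real.pi : ℂ) / (2 * z)) ^ ((1 : ℂ) / 2))).div a3.csin (by rw [hsin]; norm_num)
  refine key.deriv.trans ?_
  simp only [Function.comp, Pi.mul_apply, Pi.sub_apply]
  have b1 : besselJ (-1 / 2) z = (z / 2) ^ (-1 / 2 : ℂ) * ∑' k, bterm (z ^ 2 / 4) k (-1 / 2) := rfl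
  rw [hcos, hsin, v1, v2, b1]
  change _ = -((( (Real.eulerMascheroniConstant : ℂ) + Complex.log (2 * z) + cinS (2 * z)) * sin z -
    (sinS (2 * z) - Real.pi) * cos z) / z)
  have t1 := bsum_half z
  have t2 := bsum_neg_half z
  have t3 := bsum_deriv_half z
  have t4 := sqrt_prod z hs
  have hlog2 : log (2 : ℂ) = ((Real.log 2 : ℝ) : ℂ) := by
    rw [ofReal_log zero_le_two]; simp
  have l1 : log (2 * z) = Real.log 2 + log z := by
    have := log_ofReal_mul two_pos hz0
    simpa using this
  have l2 : log (z / 2) = log z - Real.log 2 := by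
    have := log_ofReal_mul (r := 1 / 2) (by norm_num) hz0
    rw [show z / 2 = ((1 / 2 : ℝ) : ℂ) * z by push_cast; ring, this,
      Real.log_div one_ne_zero two_ne_zero, Real.log_one]
    push_cast; ring
  have hB0 : (z / 2) ^ (1 / 2 : ℂ) ≠ 0 := by
    rw [Ne, cpow_eq_zero_iff]; simp [hz0]
  have hB : (z / 2) ^ (1 / 2 : ℂ) * (z / 2) ^ (1 / 2 : ℂ) = z / 2 := by
    rw [← cpow_add _ _ (div_ne_zero hz0 two_ne_zero)]; norm_num
  have hBn : (z / 2) ^ (-1 / 2 : ℂ) = ((z / 2) ^ (1 / 2 : ℂ))⁻¹ := by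
    rw [← cpow_neg]; norm_num
  have hP := pi_half_ne
  rw [l1, l2, hBn]
  rw [hlog2] at t3
  rw [t2]
  have hAB : ((Real.pi : ℂ) / (2 * z)) ^ ((1 : ℂ) / 2) * ((z / 2) ^ (1 / 2 : ℂ))⁻¹ =
      (Real.pi : ℂ) ^ (1 / 2 : ℂ) / z := by
    rw [eq_div_iff hz0, ← div_eq_mul_inv, div_mul_eq_mul_div, div_eq_iff hB0]
    have hB' : z = 2 * ((z / 2) ^ (1 / 2 : ℂ) * (z / 2) ^ (1 / 2 : ℂ)) := by rw [hB]; ring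
    generalize (z / 2) ^ (1 / 2 : ℂ) = B at *
    generalize ((Real.pi : ℂ) / (2 * z)) ^ ((1 : ℂ) / 2) = A at *
    linear_combination A * hB' + 2 * B * t4
  generalize (z / 2) ^ (1 / 2 : ℂ) = B at *
  generalize ((Real.pi : ℂ) / (2 * z)) ^ ((1 : ℂ) / 2) = A at *
  generalize (Real.pi : ℂ) ^ (1 / 2 : ℂ) = P at *
  generalize deriv (fun μ => ∑' (k : ℕ), bterm (z ^ 2 / 4) k μ) (1 / 2) = D1 at *
  generalize (∑' (k : ℕ), bterm (z ^ 2 / 4) k (1 / 2)) = T1 at *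
  have t1' : T1 = 2 / P * sin z / z := by rw [eq_div_iff hz0, ← t1]; ring
  have t3' := (eq_div_iff hz0).mpr ((mul_comm D1 z).trans t3)
  have e0 : ∀ X Y : ℂ, (A * (X * 1 * 0 + B⁻¹ * (1 / P * cos z) * (- -1 * (1 * (Real.pi : ℂ))) -
      (B * (log z - Real.log 2) * T1 + B * D1) * -1) * -1 - Y * (0 * (1 * (Real.pi : ℂ)))) / (-1) ^ 2 =
      -((A * B⁻¹) * (1 / P * cos z * Real.pi) + (A * B) * ((log z - Real.log 2) * T1 + D1)) := by
    intro X Y; ring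
  refine (e0 _ _).trans ?_
  rw [hAB, t4, t1', t3']
  field_simp
  ring
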